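/- For every continuously differentiable, compactly supported function u : ℝ² → ℝ, the Ladyzhenskaya inequality holds: ∫_{ℝ²} u(x)⁴ dx ≤ 2 · (∫_{ℝ²} u(x)² dx) · (∫_{ℝ²} |∇u(x)|² dx), where |∇u(x)|² = (∂₁u(x))² + (∂₂u(x))². -/

import Mathlib

open MeasureTheory

/-- Partial derivative `∂_j f` of a scalar function on `ℝ²`. -/
noncomputable def pderiv2 (j : Fin 2) (f : (Fin 2 → ℝ) → ℝ) (x : Fin 2 → ℝ) : ℝ :=
  fderiv ℝ f x (Pi.single j 1)

open Function in
/-- A compactly supported `C¹` function is bounded by the integral of its `i`-th partial derivative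
along any line in the `i`-th direction. -/
theorem enorm_le_lintegral_enorm_pderiv2 {w : (Fin 2 → ℝ) → ℝ} (hw : ContDiff ℝ 1 w)
    (hws : HasCompactSupport w) (i : Fin 2) (x : Fin 2 → ℝ) :
    ‖w x‖ₑ ≤ ∫⁻ t, ‖pderiv2 i w (update x i t)‖ₑ := by
  calc ‖w x‖ₑ
    _ ≤ ∫⁻ t in Set.Iic (x i), ‖deriv (w ∘ update x i) t‖ₑ := by
        apply le_trans (by simp) (HasCompactSupport.enorm_le_lintegral_Ici_deriv _ _ _)
        · exact hw.comp (by convert! contDiff_update 1 x i)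
        · exact hws.comp_isClosedEmbedding (isClosedEmbedding_update x i)
    _ ≤ ∫⁻ t, ‖deriv (w ∘ update x i) t‖ₑ := setLIntegral_le_lintegral _ _
    _ = ∫⁻ t, ‖pderiv2 i w (update x i t)‖ₑ := by
        congr! 3 with t
        rw [fderiv_comp_deriv _ (hw.differentiable one_ne_zero).differentiableAt
          (hasDerivAt_update x i t).differentiableAt, deriv_update, pderiv2]

open Function in
theorem lintegral_mul_lintegral_update_fin_two {f g : (Fin 2 → ℝ) → ENNReal}
    (hf : Measurable f) (hg : Measurable g) :
    ∫⁻ x : Fin 2 → ℝ, (∫⁻ t, f (update x 0 t)) * (∫⁻ t, g (update x 1 t)) =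
      (∫⁻ x, f x) * ∫⁻ x, g x := by
  let e := (MeasurableEquiv.finTwoArrow (α := ℝ)).symm
  have he : MeasurePreserving e := (volume_preserving_finTwoArrow ℝ).symm _
  have h0 (p : ℝ × ℝ) (t : ℝ) : update (e p) 0 t = e (t, p.2) := by
    ext j; fin_cases j <;> rfl
  have h1 (p : ℝ × ℝ) (t : ℝ) : update (e p) 1 t = e (p.1, t) := by
    ext j; fin_cases j <;> rfl
  have hfe : Measurable fun p => f (e p) := hf.comp e.measurable
  have hge : Measurable fun p => g (e p) := hg.comp e.measurable
  rw [← he.lintegral_comp_emb e.measurableEmbedding, ← he.lintegral_comp_emb e.measurableEmbedding,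
    ← he.lintegral_comp_emb e.measurableEmbedding]
  simp_rw [h0, h1, mul_comm (∫⁻ t, f _)]
  rw [Measure.volume_eq_prod, lintegral_prod_mul (f := fun a => ∫⁻ t, g (e (a, t)))
    (g := fun b => ∫⁻ t, f (e (t, b))) hge.lintegral_prod_right'.aemeasurable
    hfe.lintegral_prod_left'.aemeasurable, lintegral_prod_symm' _ hfe,
    lintegral_prod _ hge.aemeasurable, mul_comm]

theorem continuous_pderiv2 {f : (Fin 2 → ℝ) → ℝ} (hf : ContDiff ℝ 1 f) (j : Fin 2) :
    Continuous (pderiv2 j f) :=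
  (hf.continuous_fderiv one_ne_zero).clm_apply continuous_const

theorem hasCompactSupport_pderiv2 {f : (Fin 2 → ℝ) → ℝ} (hf : HasCompactSupport f) (j : Fin 2) :
    HasCompactSupport (pderiv2 j f) :=
  hf.fderiv_apply ℝ _

theorem pderiv2_sq {f : (Fin 2 → ℝ) → ℝ} (hf : Differentiable ℝ f) (j : Fin 2) (x : Fin 2 → ℝ) :
    pderiv2 j (fun y => f y ^ 2) x = 2 * (f x * pderiv2 j f x) := by
  simp [pderiv2, fderiv_fun_pow 2 (hf x), mul_assoc]

theorem integral_sq_le_integral_abs_pderiv2_mul {w : (Fin 2 → ℝ) → ℝ} (hw : ContDiff ℝ 1 w)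
    (hws : HasCompactSupport w) :
    ∫ x, w x ^ 2 ≤ (∫ x, |pderiv2 0 w x|) * ∫ x, |pderiv2 1 w x| := by
  have hint (j : Fin 2) : Integrable (pderiv2 j w) :=
    (continuous_pderiv2 hw j).integrable_of_hasCompactSupport (hasCompactSupport_pderiv2 hws j)
  have hmeas (j : Fin 2) : Measurable fun x => ‖pderiv2 j w x‖ₑ :=
    (continuous_pderiv2 hw j).enorm.measurable
  have hw2 : Integrable fun x => w x ^ 2 :=
    (hw.continuous.memLp_of_hasCompactSupport hws).integrable_sq
  have hlint : ∫⁻ x, ENNReal.ofReal (w x ^ 2) ≤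
      (∫⁻ x, ‖pderiv2 0 w x‖ₑ) * ∫⁻ x, ‖pderiv2 1 w x‖ₑ := by
    rw [← lintegral_mul_lintegral_update_fin_two (hmeas 0) (hmeas 1)]
    refine lintegral_mono fun x => ?_
    rw [← Real.enorm_of_nonneg (sq_nonneg (w x)), enorm_pow, sq]
    exact mul_le_mul' (enorm_le_lintegral_enorm_pderiv2 hw hws 0 x)
      (enorm_le_lintegral_enorm_pderiv2 hw hws 1 x)
  rw [← ofReal_integral_norm_eq_lintegral_enorm (hint 0),
    ← ofReal_integral_norm_eq_lintegral_enorm (hint 1),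
    ← ofReal_integral_eq_lintegral_ofReal hw2 (.of_forall fun x => sq_nonneg (w x)),
    ← ENNReal.ofReal_mul (integral_nonneg fun x => norm_nonneg _)] at hlint
  exact (ENNReal.ofReal_le_ofReal_iff (mul_nonneg (integral_nonneg fun x => norm_nonneg _)
    (integral_nonneg fun x => norm_nonneg _))).1 hlint

theorem sq_integral_abs_mul_le {α : Type*} [MeasurableSpace α] {μ : Measure α} {f g : α → ℝ}
    (hf : MemLp f 2 μ) (hg : MemLp g 2 μ) :
    (∫ x, |f x * g x| ∂μ) ^ 2 ≤ (∫ x, f x ^ 2 ∂μ) * ∫ x, g x ^ 2 ∂μ := by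
  have h := integral_mul_norm_le_Lp_mul_Lq (p := 2) (q := 2) (f := f) (g := g) (μ := μ)
    Real.HolderConjugate.two_two (by simpa using hf) (by simpa using hg)
  simp_rw [← Real.sqrt_eq_rpow, Real.rpow_two, Real.norm_eq_abs, sq_abs, ← abs_mul] at h
  rw [← Real.sqrt_mul (by positivity)] at h
  exact (Real.le_sqrt (by positivity) (by positivity)).1 h

/-- The two-dimensional Ladyzhenskaya inequality
`‖u‖_{L⁴}⁴ ≤ 2 ‖u‖_{L²}² ‖∇u‖_{L²}²` for `C¹` compactly supported scalar
functions on `ℝ²`. -/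
theorem ladyzhenskaya (u : (Fin 2 → ℝ) → ℝ)
    (hu : ContDiff ℝ 1 u) (hus : HasCompactSupport u) :
    (∫ x : Fin 2 → ℝ, (u x) ^ 4) ≤
      2 * (∫ x : Fin 2 → ℝ, (u x) ^ 2) *
        (∫ x : Fin 2 → ℝ, ∑ j : Fin 2, (pderiv2 j u x) ^ 2) := by
  have hmem (j : Fin 2) : MemLp (pderiv2 j u) 2 :=
    (continuous_pderiv2 hu j).memLp_of_hasCompactSupport (hasCompactSupport_pderiv2 hus j)
  have hD (j : Fin 2) : Integrable fun x => pderiv2 j u x ^ 2 := (hmem j).integrable_sq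
  have hA (j : Fin 2) := sq_integral_abs_mul_le
    (hu.continuous.memLp_of_hasCompactSupport hus (μ := volume) (p := 2)) (hmem j)
  have h := integral_sq_le_integral_abs_pderiv2_mul (hu.pow 2)
    (hus.comp_left (g := (· ^ 2)) (by simp))
  simp_rw [pderiv2_sq (hu.differentiable one_ne_zero), ← pow_mul, abs_mul (2 : ℝ), abs_two,
    integral_const_mul] at h
  rw [integral_finsetSum _ fun j _ => hD j, Fin.sum_univ_two]
  refine h.trans ?_
  linarith [hA 0, hA 1, two_mul_le_add_sq (∫ x, |u x * pderiv2 0 u x|)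
    (∫ x, |u x * pderiv2 1 u x|)]
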